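/- arXiv:1904.07489 — 8 statements merged into one kernel-verified Lean document; each statement's English description precedes it below -/
import Mathlib

section
/- (Theorem 2.1(ii)) Let (X,d) be a metric space and let u_n (n = 1,2,…) and u belong to F_usc^1(X). If d_0(u_n, u) → 0 as n → ∞, then H([u_n]_1, [u]_1) → 0 as n → ∞. -/
open Set Filter Topology EMetric ENNReal

variable {X : Type*} [MetricSpace X]

/-- The α-cut of a fuzzy set `u`; the 0-cut is the support. -/
noncomputable def cut (u : X → ℝ) (α : ℝ) : Set X :=
  if α = 0 then closure {x | 0 < u x} else {x | α ≤ u x}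

/-- `u` is a normal, upper semi-continuous fuzzy set on `X` (member of F_usc^1(X)). -/
def FuzzyUSC (u : X → ℝ) : Prop :=
  (∀ x, u x ∈ Icc (0:ℝ) 1) ∧ ({x | 1 ≤ u x}).Nonempty ∧
    ∀ α ∈ Icc (0:ℝ) 1, IsClosed (cut u α)

/-- `t ∈ T`: strictly increasing continuous map of [0,1] onto [0,1]. -/
def IsTimeChange (t : ℝ → ℝ) : Prop :=
  ContinuousOn t (Icc 0 1) ∧ StrictMonoOn t (Icc 0 1) ∧ t '' Icc 0 1 = Icc 0 1

/-- D(t) = sup_{α ∈ [0,1]} |t(α) − α|. -/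
noncomputable def Dt (t : ℝ → ℝ) : ℝ≥0∞ :=
  ⨆ α ∈ Icc (0:ℝ) 1, edist (t α) α

/-- Supremum metric d∞(u,v) = sup_{α ∈ [0,1]} H([u]_α, [v]_α). -/
noncomputable def dInfty (u v : X → ℝ) : ℝ≥0∞ :=
  ⨆ α ∈ Icc (0:ℝ) 1, hausdorffEdist (cut u α) (cut v α)

/-- Skorokhod metric d₀. -/
noncomputable def dSkor (u v : X → ℝ) : ℝ≥0∞ :=
  sInf {ε | ∃ t, IsTimeChange t ∧ Dt t ≤ ε ∧ dInfty u (fun x => t (v x)) ≤ ε}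

/-- Endograph of a fuzzy set. -/
def endo (u : X → ℝ) : Set (X × ℝ) := {p | p.2 ∈ Icc (0:ℝ) 1 ∧ p.2 ≤ u p.1}

/-- Endograph metric H_end(u,v). -/
noncomputable def Hend (u v : X → ℝ) : ℝ≥0∞ :=
  hausdorffEdist (endo u) (endo v)


theorem IsTimeChange.map_one {t : ℝ → ℝ} (ht : IsTimeChange t) : t 1 = 1 := by
  obtain ⟨-, hmono, himg⟩ := ht
  have h1 : (1 : ℝ) ∈ Icc (0 : ℝ) 1 := by simp
  obtain ⟨a, ha, hta⟩ : (1 : ℝ) ∈ t '' Icc 0 1 := by rw [himg]; exact h1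
  have hle : t 1 ≤ 1 := (himg.subset (mem_image_of_mem t h1)).2
  exact le_antisymm hle (hta.symm.trans_le (hmono.monotoneOn ha h1 ha.2))

theorem cut_one_comp_timeChange {X : Type*} [MetricSpace X] {v : X → ℝ}
    (hv : ∀ x, v x ∈ Icc (0 : ℝ) 1) {t : ℝ → ℝ} (ht : IsTimeChange t) :
    cut (fun x => t (v x)) 1 = cut v 1 := by
  ext x
  have key := ht.2.1.le_iff_le (show (1 : ℝ) ∈ Icc (0 : ℝ) 1 by simp) (hv x)
  rw [ht.map_one] at key
  simpa [cut] using key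

theorem hausdorffEdist_cut_one_le_dSkor {X : Type*} [MetricSpace X] (u : X → ℝ) {v : X → ℝ}
    (hv : ∀ x, v x ∈ Icc (0 : ℝ) 1) :
    hausdorffEdist (cut u 1) (cut v 1) ≤ dSkor u v := by
  refine le_sInf ?_
  rintro ε ⟨t, ht, -, hε⟩
  refine le_trans ?_ hε
  rw [← cut_one_comp_timeChange hv ht]
  exact le_iSup₂ (f := fun α (_ : α ∈ Icc (0 : ℝ) 1) =>
    hausdorffEdist (cut u α) (cut (fun x => t (v x)) α)) 1 (by simp)

theorem stmt3 {X : Type*} [MetricSpace X] (u : ℕ → X → ℝ) (u₀ : X → ℝ)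
    (hu : ∀ n, FuzzyUSC (u n)) (hu₀ : FuzzyUSC u₀)
    (h : Tendsto (fun n => dSkor (u n) u₀) atTop (𝓝 0)) :
    Tendsto (fun n => hausdorffEdist (cut (u n) 1) (cut u₀ 1)) atTop (𝓝 0) := by
  exact tendsto_of_tendsto_of_tendsto_of_le_of_le tendsto_const_nhds h (fun _ => zero_le)
    fun n => hausdorffEdist_cut_one_le_dSkor (u n) hu₀.1
end

section
/- (Theorem 2.1(iii)) Let (X,d) be a metric space and let u_n (n = 1,2,…) and u belong to F_usc^1(X). If d_0(u_n, u) → 0 as n → ∞, then H_end(u_n, u) → 0 as n → ∞; that is, Skorokhod metric convergence implies endograph metric convergence on F_usc^1(X). -/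
open Set Filter Topology EMetric ENNReal

variable {X : Type*} [MetricSpace X]

theorem mem_cut_of_pos {u : X → ℝ} {α : ℝ} (hα : 0 < α) {x : X} : x ∈ cut u α ↔ α ≤ u x := by
  simp [cut, hα.ne']

theorem edist_le_Dt (t : ℝ → ℝ) {α : ℝ} (hα : α ∈ Icc (0:ℝ) 1) : edist (t α) α ≤ Dt t :=
  le_iSup₂ (f := fun α (_ : α ∈ Icc (0:ℝ) 1) => edist (t α) α) α hα

theorem hausdorffEDist_cut_le_dInfty (u v : X → ℝ) {α : ℝ} (hα : α ∈ Icc (0:ℝ) 1) :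
    Metric.hausdorffEDist (cut u α) (cut v α) ≤ dInfty u v :=
  le_iSup₂ (f := fun α (_ : α ∈ Icc (0:ℝ) 1) => Metric.hausdorffEDist (cut u α) (cut v α)) α hα

/-- Lowering the height `α` to `min α b` moves it by at most the distance between two reals
`c ≥ α` and `a ≤ b`. -/
theorem edist_min_le {α a b c : ℝ} (hc : α ≤ c) (ha : a ≤ b) :
    edist α (min α b) ≤ edist c a := by
  rw [edist_dist, edist_dist]
  refine ENNReal.ofReal_le_ofReal ?_
  rw [Real.dist_eq, Real.dist_eq]
  rcases le_total α b with h | h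
  · simp [min_eq_left h]
  · rw [min_eq_right h, abs_of_nonneg (by linarith), abs_of_nonneg (by linarith)]
    linarith

/-- The endograph metric is dominated by the Skorokhod metric. -/
theorem Hend_le_dSkor {u v : X → ℝ} (hu : ∀ x, u x ∈ Icc (0:ℝ) 1)
    (hv : ∀ x, v x ∈ Icc (0:ℝ) 1) : Hend u v ≤ dSkor u v := by
  refine le_sInf ?_
  rintro ε ⟨t, ⟨-, hmono, himg⟩, hD, hd⟩
  have hmaps : ∀ α ∈ Icc (0:ℝ) 1, t α ∈ Icc (0:ℝ) 1 := fun α hα => himg ▸ mem_image_of_mem t hα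
  refine le_of_forall_gt_imp_ge_of_dense fun δ hδ => ?_
  refine Metric.hausdorffEDist_le_of_mem_edist ?_ ?_
  · rintro ⟨x, α⟩ ⟨hα, hx⟩
    dsimp only at hα hx
    rcases hα.1.eq_or_lt with rfl | hpos
    · exact ⟨(x, 0), ⟨hα, (hv x).1⟩, by simp⟩
    obtain ⟨y, hy, hxy⟩ := Metric.exists_edist_lt_of_hausdorffEDist_lt
      ((mem_cut_of_pos hpos).2 hx)
      (((hausdorffEDist_cut_le_dInfty u (fun x => t (v x)) hα).trans hd).trans_lt hδ)
    rw [mem_cut_of_pos hpos] at hy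
    refine ⟨(y, min α (v y)), ⟨⟨le_min hα.1 (hv y).1, (min_le_left _ _).trans hα.2⟩,
      min_le_right _ _⟩, ?_⟩
    rw [Prod.edist_eq]
    exact max_le hxy.le
      ((edist_min_le hy le_rfl).trans (((edist_le_Dt t (hv y)).trans hD).trans hδ.le))
  · rintro ⟨y, α⟩ ⟨hα, hy⟩
    dsimp only at hα hy
    rcases hα.1.eq_or_lt with rfl | hpos
    · exact ⟨(y, 0), ⟨hα, (hu y).1⟩, by simp⟩
    have h0 : (0:ℝ) ∈ Icc (0:ℝ) 1 := ⟨le_rfl, zero_le_one⟩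
    have htpos : 0 < t α := (hmaps 0 h0).1.trans_lt (hmono h0 hα hpos)
    have hty : t α ≤ t (v y) := hmono.monotoneOn hα (hv y) hy
    have hmem : y ∈ cut (fun x => t (v x)) (t α) := (mem_cut_of_pos htpos).2 hty
    obtain ⟨x, hx, hxy⟩ := Metric.exists_edist_lt_of_hausdorffEDist_lt hmem
      (Metric.hausdorffEDist_comm.trans_lt <|
        ((hausdorffEDist_cut_le_dInfty u (fun x => t (v x)) (hmaps α hα)).trans hd).trans_lt hδ)
    rw [mem_cut_of_pos htpos] at hx
    refine ⟨(x, min α (u x)), ⟨⟨le_min hα.1 (hu x).1, (min_le_left _ _).trans hα.2⟩,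
      min_le_right _ _⟩, ?_⟩
    rw [Prod.edist_eq]
    refine max_le hxy.le ((edist_min_le le_rfl hx).trans ?_)
    rw [edist_comm]
    exact ((edist_le_Dt t hα).trans hD).trans hδ.le

theorem stmt4 {X : Type*} [MetricSpace X] (u : ℕ → X → ℝ) (u₀ : X → ℝ)
    (hu : ∀ n, FuzzyUSC (u n)) (hu₀ : FuzzyUSC u₀)
    (h : Tendsto (fun n => dSkor (u n) u₀) atTop (𝓝 0)) :
    Tendsto (fun n => Hend (u n) u₀) atTop (𝓝 0) :=
  tendsto_of_tendsto_of_tendsto_of_le_of_le tendsto_const_nhds h (fun _ => zero_le)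
    fun n => Hend_le_dSkor (hu n).1 hu₀.1
end

section
/- (Theorem 2.1(iv)) Let (X,d) be a metric space and let u_n (n = 1,2,…) and u belong to F_usc^1(X). If d_0(u_n, u) → 0 as n → ∞, then H([u_n]_α, [u]_α) → 0 as n → ∞ for every α ∈ (0,1) \ P_0(u), i.e. for every α ∈ (0,1) at which the map β ↦ [u]_β is continuous with respect to the Hausdorff metric. -/
open Set Filter Topology EMetric ENNReal

variable {X : Type*} [MetricSpace X]

/-- A time change on the left of a fuzzy set reparametrizes its cuts. -/
lemma cut_timeChange {X : Type*} [MetricSpace X] {u : X → ℝ} (hu : FuzzyUSC u) {t : ℝ → ℝ}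
    (ht : IsTimeChange t) {β : ℝ} (hβ : β ∈ Icc (0:ℝ) 1) (hβ₀ : β ≠ 0) (htβ₀ : t β ≠ 0) :
    cut (fun x => t (u x)) (t β) = cut u β := by
  ext x
  simp only [cut, if_neg hβ₀, if_neg htβ₀, mem_ofPred_eq]
  exact ht.2.1.le_iff_le hβ (hu.1 x)

/-- If the Skorokhod distance from `u` to `v` is less than `ε`, every cut of `u` at
a level at least `ε` away from `0` is `ε`-close to a cut of `v` at an `ε`-close level. -/
lemma exists_hausdorffEDist_cut_lt {X : Type*} [MetricSpace X] {u v : X → ℝ} (hv : FuzzyUSC v)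
    {ε : ℝ≥0∞} (h : dSkor u v < ε) {α : ℝ} (hα : α ∈ Ioc (0:ℝ) 1) (hε : ε ≤ edist 0 α) :
    ∃ β ∈ Icc (0:ℝ) 1, edist β α < ε ∧ Metric.hausdorffEDist (cut u α) (cut v β) < ε := by
  obtain ⟨e, ⟨t, ht, hD, hd⟩, he⟩ := sInf_lt_iff.1 h
  have hα' : α ∈ Icc (0:ℝ) 1 := Ioc_subset_Icc_self hα
  obtain ⟨β, hβ, rfl⟩ : α ∈ t '' Icc 0 1 := ht.2.2.symm ▸ hα'
  have hclose : edist β (t β) < ε := by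
    rw [edist_comm]
    exact (le_iSup₂_of_le (f := fun a (_ : a ∈ Icc (0:ℝ) 1) => edist (t a) a) β hβ le_rfl
      |>.trans hD).trans_lt he
  have hβ₀ : β ≠ 0 := by
    rintro rfl
    exact (hclose.trans_le hε).false
  refine ⟨β, hβ, hclose, ?_⟩
  rw [← cut_timeChange hv ht hβ hβ₀ hα.1.ne']
  exact (le_iSup₂_of_le (f := fun a (_ : a ∈ Icc (0:ℝ) 1) =>
    Metric.hausdorffEDist (cut u a) (cut (fun x => t (v x)) a)) (t β) hα' le_rfl |>.trans hd).trans_lt he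

theorem stmt5 {X : Type*} [MetricSpace X] (u : ℕ → X → ℝ) (u₀ : X → ℝ)
    (hu : ∀ n, FuzzyUSC (u n)) (hu₀ : FuzzyUSC u₀)
    (h : Tendsto (fun n => dSkor (u n) u₀) atTop (𝓝 0)) :
    ∀ α ∈ Ioo (0:ℝ) 1,
      Tendsto (fun β => hausdorffEdist (cut u₀ β) (cut u₀ α)) (𝓝[Ioo (0:ℝ) 1] α) (𝓝 0) →
      Tendsto (fun n => hausdorffEdist (cut (u n) α) (cut u₀ α)) atTop (𝓝 0) := by
  intro α hα hcont
  rw [IsOpen.nhdsWithin_eq isOpen_Ioo hα, ENNReal.tendsto_nhds_zero] at hcont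
  rw [ENNReal.tendsto_nhds_zero]
  intro ε hε
  have hε2 : 0 < ε / 2 := ENNReal.half_pos hε.ne'
  obtain ⟨r, hr, hball⟩ := EMetric.mem_nhds_iff.1 (hcont (ε / 2) hε2)
  have hα₀ : 0 < edist 0 α := edist_pos.2 hα.1.ne
  filter_upwards [h.eventually (gt_mem_nhds (lt_min (lt_min hr hε2) hα₀))] with n hn
  obtain ⟨β, -, hβα, hβ⟩ :=
    exists_hausdorffEDist_cut_lt hu₀ hn (Ioo_subset_Ioc_self hα) (min_le_right _ _)
  have hβr : edist β α < r := hβα.trans_le ((min_le_left _ _).trans (min_le_left _ _))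
  have hβε : Metric.hausdorffEDist (cut (u n) α) (cut u₀ β) ≤ ε / 2 :=
    hβ.le.trans ((min_le_left _ _).trans (min_le_right _ _))
  calc Metric.hausdorffEDist (cut (u n) α) (cut u₀ α)
      ≤ Metric.hausdorffEDist (cut (u n) α) (cut u₀ β) + Metric.hausdorffEDist (cut u₀ β) (cut u₀ α) :=
        Metric.hausdorffEDist_triangle
    _ ≤ ε / 2 + ε / 2 := add_le_add hβε (hball hβr)
    _ = ε := ENNReal.add_halves ε
end

section
/- For n ≥ 1, let u_n : ℝ → [0,1] be defined by u_n(x) = 1 − (1/2)x^{1/n} for x ∈ [0,1], u_n(x) = (1/2)(1 − (x−1)^n) for x ∈ [1,2], and u_n(x) = 0 otherwise. Then the α-cuts of u_n are: [u_n]_α = [0, (2−2α)^n] for α ∈ [1/2, 1], and [u_n]_α = [0, 1 + (1−2α)^{1/n}] for α ∈ [0, 1/2]. -/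
open Set Filter Topology EMetric ENNReal

variable {X : Type*} [MetricSpace X]

/-- The fuzzy set u₀ of the example. -/
noncomputable def uZero : ℝ → ℝ := fun x =>
  if x = 0 then 1 else if x ∈ Ioc (0:ℝ) 2 then 1/2 else 0

/-- The fuzzy sets uₙ of the example. -/
noncomputable def uSeq (n : ℕ) : ℝ → ℝ := fun x =>
  if x ∈ Icc (0:ℝ) 1 then 1 - (1/2) * x ^ ((1:ℝ)/(n:ℝ))
  else if x ∈ Icc (1:ℝ) 2 then (1/2) * (1 - (x-1)^n) else 0

theorem rpow_one_div_natCast_le_iff {n : ℕ} (hn : n ≠ 0) {x y : ℝ} (hx : 0 ≤ x) (hy : 0 ≤ y) :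
    x ^ ((1 : ℝ) / (n : ℝ)) ≤ y ↔ x ≤ y ^ n := by
  rw [← pow_le_pow_iff_left₀ (Real.rpow_nonneg hx _) hy hn, one_div,
    Real.rpow_inv_natCast_pow hx hn]

theorem le_rpow_one_div_natCast_iff {n : ℕ} (hn : n ≠ 0) {x y : ℝ} (hx : 0 ≤ x) (hy : 0 ≤ y) :
    y ≤ x ^ ((1 : ℝ) / (n : ℝ)) ↔ y ^ n ≤ x := by
  rw [← pow_le_pow_iff_left₀ hy (Real.rpow_nonneg hx _) hn, one_div,
    Real.rpow_inv_natCast_pow hx hn]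

theorem cut_uSeq_of_half_le {n : ℕ} (hn : n ≠ 0) {α : ℝ} (hα : α ∈ Icc (1 / 2 : ℝ) 1) :
    cut (uSeq n) α = Icc 0 ((2 - 2 * α) ^ n) := by
  obtain ⟨h1, h2⟩ := hα
  have hb : (2 - 2 * α) ^ n ≤ 1 := pow_le_one₀ (by linarith) (by linarith)
  rw [cut, if_neg (by linarith)]
  ext x
  simp only [mem_ofPred_eq, uSeq, mem_Icc]
  split_ifs with hx hx'
  · have := rpow_one_div_natCast_le_iff hn hx.1 (show 0 ≤ 2 - 2 * α by linarith)
    constructor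
    · exact fun h => ⟨hx.1, this.1 (by linarith)⟩
    · exact fun h => by linarith [this.2 h.2]
  · have hx1 : 1 < x := lt_of_not_ge fun h => hx ⟨by linarith, h⟩
    have : 0 < (x - 1) ^ n := pow_pos (by linarith) n
    constructor <;> intro h <;> linarith [h]
  · constructor
    · intro h
      linarith
    · exact fun h => absurd ⟨h.1, h.2.trans hb⟩ hx

theorem cut_uSeq_of_pos_of_le_half {n : ℕ} (hn : n ≠ 0) {α : ℝ} (hα : α ∈ Ioc (0 : ℝ) (1 / 2)) :
    cut (uSeq n) α = Icc 0 (1 + (1 - 2 * α) ^ ((1 : ℝ) / (n : ℝ))) := by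
  obtain ⟨h1, h2⟩ := hα
  have h0 : 0 ≤ 1 - 2 * α := by linarith
  have hb0 := Real.rpow_nonneg h0 ((1 : ℝ) / (n : ℝ))
  have hb : (1 - 2 * α) ^ ((1 : ℝ) / (n : ℝ)) ≤ 1 :=
    Real.rpow_le_one h0 (by linarith) (by positivity)
  rw [cut, if_neg h1.ne']
  ext x
  simp only [mem_ofPred_eq, uSeq, mem_Icc]
  split_ifs with hx hx'
  · have := Real.rpow_le_one hx.1 hx.2 (show 0 ≤ (1 : ℝ) / (n : ℝ) by positivity)
    exact ⟨fun _ => ⟨hx.1, by linarith [hx.2]⟩, fun _ => by linarith⟩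
  · have := le_rpow_one_div_natCast_iff hn h0 (show 0 ≤ x - 1 by linarith [hx'.1])
    constructor
    · exact fun h => ⟨by linarith [hx'.1], by linarith [this.2 (by linarith)]⟩
    · exact fun h => by linarith [this.1 (by linarith [h.2])]
  · constructor
    · intro h
      linarith
    · intro h
      rcases le_total x 1 with h' | h'
      · exact absurd ⟨h.1, h'⟩ hx
      · exact absurd ⟨h', by linarith [h.2]⟩ hx'

theorem setOf_uSeq_pos {n : ℕ} (hn : n ≠ 0) : {x | 0 < uSeq n x} = Ico 0 2 := by
  ext x
  simp only [mem_ofPred_eq, uSeq, mem_Icc, mem_Ico]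
  split_ifs with hx hx'
  · have := Real.rpow_le_one hx.1 hx.2 (show 0 ≤ (1 : ℝ) / (n : ℝ) by positivity)
    exact ⟨fun _ => ⟨hx.1, by linarith [hx.2]⟩, fun _ => by linarith⟩
  · have := pow_lt_one_iff_of_nonneg (show 0 ≤ x - 1 by linarith [hx'.1]) hn
    constructor
    · exact fun h => ⟨by linarith [hx'.1], by linarith [this.1 (by linarith)]⟩
    · exact fun h => by linarith [this.2 (by linarith [h.2])]
  · refine ⟨fun h => absurd h (lt_irrefl _), fun h => ?_⟩
    rcases le_total x 1 with h' | h'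
    · exact absurd ⟨h.1, h'⟩ hx
    · exact absurd ⟨h', h.2.le⟩ hx'

theorem stmt8 (n : ℕ) (hn : 1 ≤ n) :
    (∀ α ∈ Icc (1/2 : ℝ) 1, cut (uSeq n) α = Icc 0 ((2 - 2*α)^n)) ∧
    (∀ α ∈ Icc (0:ℝ) (1/2), cut (uSeq n) α = Icc 0 (1 + (1 - 2*α) ^ ((1:ℝ)/(n:ℝ)))) := by
  have hn0 : n ≠ 0 := by omega
  refine ⟨fun α hα => cut_uSeq_of_half_le hn0 hα, fun α hα => ?_⟩
  rcases hα.1.eq_or_lt with rfl | h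
  · rw [cut, if_pos rfl, setOf_uSeq_pos hn0, closure_Ico (by norm_num)]
    norm_num
  · exact cut_uSeq_of_pos_of_le_half hn0 ⟨h, hα.2⟩
end

section
/- Let u_0 : ℝ → [0,1] be defined by u_0(x) = 1 if x = 0, u_0(x) = 1/2 if x ∈ (0,2], and u_0(x) = 0 otherwise; and for n ≥ 1 let u_n : ℝ → [0,1] be defined by u_n(x) = 1 − (1/2)x^{1/n} for x ∈ [0,1], u_n(x) = (1/2)(1 − (x−1)^n) for x ∈ [1,2], and u_n(x) = 0 otherwise. Then d_0(u_n, u_0) ≥ 1 for all n = 1, 2, …; in particular d_0(u_n, u_0) does not converge to 0. -/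
open Set Filter Topology EMetric ENNReal

variable {X : Type*} [MetricSpace X]

lemma one_le_hausdorffEDist {s t : Set ℝ} {x : ℝ} (hx : x ∈ s)
    (h : ∀ y ∈ t, 1 ≤ dist x y) : 1 ≤ Metric.hausdorffEDist s t := by
  refine le_trans ?_ (Metric.infEDist_le_hausdorffEDist_of_mem hx)
  refine Metric.le_infEDist.2 fun y hy => ?_
  rw [edist_dist, ENNReal.one_le_ofReal]
  exact h y hy

lemma uSeq_lt_half {n : ℕ} {x : ℝ} (hx : 1 < x) : uSeq n x < 1 / 2 := by
  have hpow : 0 < (x - 1) ^ n := pow_pos (by linarith) n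
  have hx' : x ∉ Icc (0:ℝ) 1 := fun h => absurd h.2 (not_le.2 hx)
  unfold uSeq
  rw [if_neg hx']
  split_ifs
  · linarith
  · norm_num

lemma uSeq_one (n : ℕ) : uSeq n 1 = 1 / 2 := by
  norm_num [uSeq]

lemma one_le_dInfty_of_isTimeChange (n : ℕ) {t : ℝ → ℝ} (ht : IsTimeChange t) :
    1 ≤ dInfty (uSeq n) (fun x => t (uZero x)) := by
  obtain ⟨-, hmono, himg⟩ := ht
  have hmem : (1 / 2 : ℝ) ∈ Icc (0:ℝ) 1 := by norm_num
  have htc : t (1 / 2) ∈ Icc (0:ℝ) 1 := himg ▸ mem_image_of_mem t hmem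
  have h0 : t 0 < t (1 / 2) := hmono (by norm_num) hmem (by norm_num)
  rcases le_or_gt (1 / 2) (t (1 / 2)) with hc | hc
  · refine le_trans ?_ (le_iSup₂ (f := fun α (_ : α ∈ Icc (0:ℝ) 1) => _) (t (1 / 2)) htc)
    have hne : t (1 / 2) ≠ 0 := by linarith
    simp only [cut, if_neg hne]
    refine (one_le_hausdorffEDist (x := 2) ?_ fun y hy => ?_).trans_eq
      Metric.hausdorffEDist_comm
    · norm_num [uZero]
    · have hy1 : y ≤ 1 := by
        by_contra! h
        exact absurd (hc.trans hy) (not_le.2 (uSeq_lt_half h))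
      rw [Real.dist_eq]
      exact le_trans (by linarith) (le_abs_self _)
  · refine le_trans ?_ (le_iSup₂ (f := fun α (_ : α ∈ Icc (0:ℝ) 1) => _) (1 / 2) hmem)
    have hne : (1 / 2 : ℝ) ≠ 0 := by norm_num
    simp only [cut, if_neg hne]
    refine one_le_hausdorffEDist (x := 1) (uSeq_one n).ge fun y hy => ?_
    have hy0 : y = 0 := by
      by_contra h
      rw [mem_ofPred_eq, uZero, if_neg h] at hy
      split_ifs at hy <;> linarith
    norm_num [hy0]

lemma one_le_dSkor_uSeq (n : ℕ) : 1 ≤ dSkor (uSeq n) uZero := by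
  refine le_sInf ?_
  rintro ε ⟨t, ht, -, hε⟩
  exact (one_le_dInfty_of_isTimeChange n ht).trans hε

theorem stmt9 :
    (∀ n : ℕ, 1 ≤ n → 1 ≤ dSkor (uSeq n) uZero) ∧
    ¬ Tendsto (fun n => dSkor (uSeq n) uZero) atTop (𝓝 0) := by
  refine ⟨fun n _ => one_le_dSkor_uSeq n, fun h => ?_⟩
  exact absurd (ge_of_tendsto' h one_le_dSkor_uSeq) (by simp)
end

section
/- Let u_0 : ℝ → [0,1] be defined by u_0(x) = 1 if x = 0, u_0(x) = 1/2 if x ∈ (0,2], and u_0(x) = 0 otherwise; and for n ≥ 1 let u_n : ℝ → [0,1] be defined by u_n(x) = 1 − (1/2)x^{1/n} for x ∈ [0,1], u_n(x) = (1/2)(1 − (x−1)^n) for x ∈ [1,2], and u_n(x) = 0 otherwise. Then H([u_n]_α, [u_0]_α) → 0 as n → ∞ for every α ∈ [0,1] with α ≠ 1/2. -/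
open Set Filter Topology EMetric ENNReal

variable {X : Type*} [MetricSpace X]

/-- Hausdorff convergence to a fixed set from two-sided approximation by points. -/
theorem tendsto_hausdorffEDist_of_eventually_dist_le {Y : Type*} [PseudoMetricSpace Y]
    {A : ℕ → Set Y} {B : Set Y}
    (h : ∀ δ : ℝ, 0 < δ → ∀ᶠ n in atTop,
      (∀ x ∈ A n, ∃ y ∈ B, dist x y ≤ δ) ∧ ∀ y ∈ B, ∃ x ∈ A n, dist y x ≤ δ) :
    Tendsto (fun n => Metric.hausdorffEDist (A n) B) atTop (𝓝 0) := by
  rw [ENNReal.tendsto_nhds_zero]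
  intro ε hε
  obtain ⟨δ, hδ, hδε⟩ := ENNReal.lt_iff_exists_nnreal_btwn.1 hε
  filter_upwards [h δ (by exact_mod_cast hδ)] with n hn
  have key : ∀ x y : Y, dist x y ≤ δ → edist x y ≤ ε := fun x y hxy =>
    (edist_le_coe.2 (by exact_mod_cast hxy)).trans hδε.le
  refine Metric.hausdorffEDist_le_of_mem_edist (fun x hx => ?_) (fun y hy => ?_)
  · obtain ⟨y, hy, hxy⟩ := hn.1 x hx
    exact ⟨y, hy, key _ _ hxy⟩
  · obtain ⟨x, hx, hyx⟩ := hn.2 y hy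
    exact ⟨x, hx, key _ _ hyx⟩

theorem cut_subset_Icc {u : ℝ → ℝ} (hu : ∀ x, 0 < u x → x ∈ Icc (0:ℝ) 2) {α : ℝ} (hα : 0 ≤ α) :
    cut u α ⊆ Icc 0 2 := by
  unfold cut
  split_ifs with h
  · exact closure_minimal hu isClosed_Icc
  · exact fun x hx => hu x ((hα.lt_of_ne' h).trans_le hx)

theorem mem_cut_of_lt {u : ℝ → ℝ} {x α : ℝ} (h : α < u x) : x ∈ cut u α := by
  unfold cut
  split_ifs with h0
  · exact subset_closure (by simpa [h0] using h)
  · exact h.le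

theorem mem_Icc_of_uZero_pos {x : ℝ} (hx : 0 < uZero x) : x ∈ Icc (0:ℝ) 2 := by
  unfold uZero at hx
  split_ifs at hx with h1 h2
  · simp [h1]
  · exact Ioc_subset_Icc_self h2
  · exact absurd hx (lt_irrefl _)

theorem half_le_uZero {x : ℝ} (hx : x ∈ Icc (0:ℝ) 2) : 1 / 2 ≤ uZero x := by
  unfold uZero
  split_ifs with h1 h2
  · norm_num
  · exact le_rfl
  · exact absurd ⟨hx.1.lt_of_ne' h1, hx.2⟩ h2

theorem mem_Icc_of_uSeq_pos {n : ℕ} {x : ℝ} (hx : 0 < uSeq n x) : x ∈ Icc (0:ℝ) 2 := by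
  unfold uSeq at hx
  split_ifs at hx with h1 h2
  · exact ⟨h1.1, by linarith [h1.2]⟩
  · exact ⟨by linarith [h2.1], h2.2⟩
  · exact absurd hx (lt_irrefl _)

theorem half_le_uSeq {n : ℕ} {x : ℝ} (hx : x ∈ Icc (0:ℝ) 1) : 1 / 2 ≤ uSeq n x := by
  have := Real.rpow_le_one hx.1 hx.2 (show (0:ℝ) ≤ 1 / n by positivity)
  rw [uSeq, if_pos hx]
  linarith

theorem uSeq_of_one_lt {n : ℕ} {x : ℝ} (h1 : 1 < x) (h2 : x ≤ 2) :
    uSeq n x = (1 / 2) * (1 - (x - 1) ^ n) := by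
  rw [uSeq, if_neg fun h => h1.not_ge h.2, if_pos ⟨h1.le, h2⟩]

theorem cut_uZero_of_half_lt {α : ℝ} (h : 1 / 2 < α) (h1 : α ≤ 1) : cut uZero α = {0} := by
  ext x
  rw [cut, if_neg (by linarith), mem_ofPred_eq, mem_singleton_iff]
  unfold uZero
  split_ifs with hx hx'
  · simp [hx, h1]
  · exact ⟨fun _ => by linarith, fun h => absurd h hx⟩
  · exact ⟨fun _ => by linarith, fun h => absurd h hx⟩

theorem zero_mem_cut_uSeq {n : ℕ} (hn : n ≠ 0) {α : ℝ} (h : 1 / 2 < α) (h1 : α ≤ 1) :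
    (0 : ℝ) ∈ cut (uSeq n) α := by
  have : (1:ℝ) / n ≠ 0 := by positivity
  rw [cut, if_neg (by linarith), mem_ofPred_eq, uSeq, if_pos (by simp), Real.zero_rpow this]
  linarith

/-- Above level `1/2` the cuts of `uSeq n` shrink to the origin geometrically. -/
theorem cut_uSeq_subset_Icc_pow {n : ℕ} (hn : n ≠ 0) {α : ℝ} (h : 1 / 2 < α) :
    cut (uSeq n) α ⊆ Icc 0 ((2 - 2 * α) ^ n) := by
  intro x hx
  rw [cut, if_neg (by linarith), mem_ofPred_eq] at hx
  have hx2 := mem_Icc_of_uSeq_pos (n := n) (x := x) (by linarith)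
  rcases le_or_gt x 1 with hx1 | hx1
  · rw [uSeq, if_pos ⟨hx2.1, hx1⟩, one_div (n : ℝ)] at hx
    refine ⟨hx2.1, ?_⟩
    calc x = (x ^ ((n : ℝ)⁻¹)) ^ n := (Real.rpow_inv_natCast_pow hx2.1 hn).symm
      _ ≤ _ := pow_le_pow_left₀ (Real.rpow_nonneg hx2.1 _) (by linarith) n
  · rw [uSeq_of_one_lt hx1 hx2.2] at hx
    have : 0 ≤ (x - 1) ^ n := pow_nonneg (by linarith) n
    linarith

/-- Below level `1/2` the cuts of `uSeq n` are eventually `δ`-dense in `[0, 2]`. -/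
theorem eventually_cut_uSeq_dense {α δ : ℝ} (h : α < 1 / 2) (hδ : 0 < δ) :
    ∀ᶠ n in atTop, ∀ y ∈ Icc (0:ℝ) 2, ∃ x ∈ cut (uSeq n) α, dist y x ≤ δ := by
  obtain ⟨r, hr, hr1⟩ : ∃ r, max 0 (1 - δ) < r ∧ r < 1 :=
    exists_between (max_lt one_pos (by linarith))
  have hr0 : 0 < r := (le_max_left _ _).trans_lt hr
  have hrδ : 1 - δ < r := (le_max_right _ _).trans_lt hr
  filter_upwards [(tendsto_pow_atTop_nhds_zero_of_lt_one hr0.le hr1).eventually_lt_const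
    (show 0 < 1 - 2 * α by linarith)] with n hn y hy
  rcases le_or_gt y 1 with hy1 | hy1
  · exact ⟨y, mem_cut_of_lt (h.trans_le (half_le_uSeq ⟨hy.1, hy1⟩)), by simp [hδ.le]⟩
  · have hy2 := hy.2
    refine ⟨1 + r * (y - 1), mem_cut_of_lt ?_, ?_⟩
    · rw [uSeq_of_one_lt (by nlinarith) (by nlinarith)]
      have : (1 + r * (y - 1) - 1) ^ n ≤ r ^ n :=
        pow_le_pow_left₀ (by nlinarith) (by nlinarith) n
      linarith
    · rw [Real.dist_eq, abs_le]
      constructor <;> nlinarith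

theorem stmt10 :
    ∀ α ∈ Icc (0:ℝ) 1, α ≠ 1/2 →
      Tendsto (fun n => hausdorffEdist (cut (uSeq n) α) (cut uZero α)) atTop (𝓝 0) := by
  intro α hα hne
  refine tendsto_hausdorffEDist_of_eventually_dist_le fun δ hδ => ?_
  rcases hne.lt_or_gt with h | h
  · filter_upwards [eventually_cut_uSeq_dense h hδ] with n hn
    refine ⟨fun x hx => ⟨x, mem_cut_of_lt (h.trans_le (half_le_uZero ?_)), by simp [hδ.le]⟩,
      fun y hy => hn y (cut_subset_Icc (fun _ => mem_Icc_of_uZero_pos) hα.1 hy)⟩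
    exact cut_subset_Icc (fun _ => mem_Icc_of_uSeq_pos) hα.1 hx
  · rw [cut_uZero_of_half_lt h hα.2]
    filter_upwards [eventually_ne_atTop 0, (tendsto_pow_atTop_nhds_zero_of_lt_one
      (show 0 ≤ 2 - 2 * α by linarith [hα.2]) (by linarith)).eventually_lt_const hδ] with n hn hnδ
    refine ⟨fun x hx => ⟨0, rfl, ?_⟩, fun y hy => ⟨0, zero_mem_cut_uSeq hn h hα.2, ?_⟩⟩
    · have hx' := cut_uSeq_subset_Icc_pow hn h hx
      rw [Real.dist_0_eq_abs, abs_of_nonneg hx'.1]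
      exact hx'.2.trans hnδ.le
    · rw [mem_singleton_iff.1 hy, dist_self]
      exact hδ.le
end

section
/- Endograph metric convergence does not imply Skorokhod metric convergence on F_usc^1(ℝ): there exist a sequence u_n (n = 1,2,…) and an element u in F_usc^1(ℝ) such that H_end(u_n, u) → 0 as n → ∞ but d_0(u_n, u) does not converge to 0. -/
open Set Filter Topology EMetric ENNReal

variable {X : Type*} [MetricSpace X]

/-- The fuzzy set on `ℝ` with value `1` at `0`, value `c` at `1`, and value `0` elsewhere. -/
noncomputable def twoPointFuzzy (c : ℝ) (x : ℝ) : ℝ :=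
  if x = 0 then 1 else if x = 1 then c else 0

lemma twoPointFuzzy_mem_Icc {c : ℝ} (hc : c ∈ Icc (0:ℝ) 1) (x : ℝ) :
    twoPointFuzzy c x ∈ Icc (0:ℝ) 1 := by
  unfold twoPointFuzzy
  split_ifs
  exacts [⟨zero_le_one, le_rfl⟩, hc, ⟨le_rfl, zero_le_one⟩]

lemma fuzzyUSC_twoPointFuzzy {c : ℝ} (hc : c ∈ Icc (0:ℝ) 1) : FuzzyUSC (twoPointFuzzy c) := by
  refine ⟨twoPointFuzzy_mem_Icc hc, ⟨0, by simp [twoPointFuzzy]⟩, fun α hα => ?_⟩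
  unfold cut
  split_ifs with h
  · exact isClosed_closure
  · refine Set.Finite.isClosed ((Set.toFinite {(0:ℝ), 1}).subset fun x hx => ?_)
    by_contra hx'
    simp only [mem_insert_iff, mem_singleton_iff, not_or] at hx'
    simp only [mem_ofPred_eq, twoPointFuzzy, if_neg hx'.1, if_neg hx'.2] at hx
    exact h (le_antisymm hx hα.1)

lemma Hend_twoPointFuzzy_zero_le {c : ℝ} (hc : 0 ≤ c) :
    Hend (twoPointFuzzy c) (twoPointFuzzy 0) ≤ ENNReal.ofReal c := by
  refine Metric.hausdorffEDist_le_of_mem_edist ?_ ?_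
  · rintro ⟨x, a⟩ ⟨⟨ha0, ha1⟩, ha⟩
    by_cases hx : x = 0
    · exact ⟨(x, a), ⟨⟨ha0, ha1⟩, by simpa [twoPointFuzzy, hx] using ha1⟩, by simp⟩
    · refine ⟨(x, 0), ⟨⟨le_rfl, zero_le_one⟩, by simp [twoPointFuzzy, hx]⟩, ?_⟩
      have hac : a ≤ c := by
        simp only [twoPointFuzzy, if_neg hx] at ha
        split_ifs at ha <;> linarith
      simp only at ha0
      rw [edist_dist]
      refine ENNReal.ofReal_le_ofReal ?_
      simp [Prod.dist_eq, abs_of_nonneg ha0, hac, hc]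
  · rintro ⟨x, a⟩ ⟨ha01, ha⟩
    refine ⟨(x, a), ⟨ha01, ha.trans ?_⟩, by simp⟩
    simp only [twoPointFuzzy]
    split_ifs <;> simp [hc]

lemma IsTimeChange.map_zero_nonpos {t : ℝ → ℝ} (ht : IsTimeChange t) : t 0 ≤ 0 := by
  obtain ⟨a, ha, hta⟩ := ht.2.2.symm ▸ (left_mem_Icc.2 zero_le_one : (0:ℝ) ∈ Icc (0:ℝ) 1)
  exact hta ▸ ht.2.1.monotoneOn (left_mem_Icc.2 zero_le_one) ha ha.1

/-- No time change can bring the supports `{0, 1}` and `{0}` closer together. -/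
lemma one_le_dSkor_twoPointFuzzy_zero {c : ℝ} (hc : 0 < c) :
    1 ≤ dSkor (twoPointFuzzy c) (twoPointFuzzy 0) := by
  refine le_sInf ?_
  rintro ε ⟨t, ht, -, hε⟩
  refine le_trans ?_ hε
  have h1 : (1:ℝ) ∈ cut (twoPointFuzzy c) 0 := by
    rw [cut, if_pos rfl]
    exact subset_closure (by simp [twoPointFuzzy, hc])
  have h0 : cut (fun x => t (twoPointFuzzy 0 x)) 0 ⊆ {(0:ℝ)} := by
    rw [cut, if_pos rfl]
    refine closure_minimal (fun x hx => ?_) isClosed_singleton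
    by_contra hx0
    have hx0 : x ≠ 0 := hx0
    have hx : 0 < t 0 := by simpa [twoPointFuzzy, hx0] using hx
    exact hx.not_ge ht.map_zero_nonpos
  calc (1:ℝ≥0∞) = Metric.infEDist (1:ℝ) {0} := by simp [edist_dist]
    _ ≤ Metric.infEDist 1 (cut (fun x => t (twoPointFuzzy 0 x)) 0) := Metric.infEDist_anti h0
    _ ≤ Metric.hausdorffEDist (cut (twoPointFuzzy c) 0) (cut (fun x => t (twoPointFuzzy 0 x)) 0) :=
      Metric.infEDist_le_hausdorffEDist_of_mem h1
    _ ≤ dInfty (twoPointFuzzy c) (fun x => t (twoPointFuzzy 0 x)) :=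
      le_iSup₂_of_le (f := fun α (_ : α ∈ Icc (0:ℝ) 1) => Metric.hausdorffEDist
        (cut (twoPointFuzzy c) α) (cut (fun x => t (twoPointFuzzy 0 x)) α))
        0 (left_mem_Icc.2 zero_le_one) le_rfl

theorem stmt12 :
    ∃ (u : ℕ → ℝ → ℝ) (v : ℝ → ℝ), (∀ n, FuzzyUSC (u n)) ∧ FuzzyUSC v ∧
      Tendsto (fun n => Hend (u n) v) atTop (𝓝 0) ∧
      ¬ Tendsto (fun n => dSkor (u n) v) atTop (𝓝 0) := by
  have hpos (n : ℕ) : (0:ℝ) < 1 / ((n:ℝ) + 1) := Nat.one_div_pos_of_nat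
  refine ⟨fun n => twoPointFuzzy (1 / ((n:ℝ) + 1)), twoPointFuzzy 0,
    fun n => fuzzyUSC_twoPointFuzzy ⟨(hpos n).le, ?_⟩,
    fuzzyUSC_twoPointFuzzy ⟨le_rfl, zero_le_one⟩, ?_, fun h => ?_⟩
  · rw [div_le_one (by positivity)]
    linarith [(Nat.cast_nonneg n : (0:ℝ) ≤ n)]
  · refine tendsto_of_tendsto_of_tendsto_of_le_of_le tendsto_const_nhds ?_
      (fun n => zero_le) (fun n => Hend_twoPointFuzzy_zero_le (hpos n).le)
    simpa using ENNReal.tendsto_ofReal (tendsto_one_div_add_atTop_nhds_zero_nat (𝕜 := ℝ))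
  · exact absurd (ge_of_tendsto' h fun n => one_le_dSkor_twoPointFuzzy_zero (hpos n)) (by simp)
end

section
/- Let u_0 : ℝ → [0,1] be defined by u_0(x) = 1 if x = 0, u_0(x) = 1/2 if x ∈ (0,2], and u_0(x) = 0 otherwise; and for n ≥ 1 let u_n : ℝ → [0,1] be defined by u_n(x) = 1 − (1/2)x^{1/n} for x ∈ [0,1], u_n(x) = (1/2)(1 − (x−1)^n) for x ∈ [1,2], and u_n(x) = 0 otherwise. Then [u_n]_{1/2} = [0,1] for every n = 1, 2, …, and for every t ∈ T and every n, d_∞(u_n, t u_0) ≥ H([u_n]_{1/2}, [u_0]_{t^{-1}(1/2)}) ≥ 1. -/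
open Set Filter Topology EMetric ENNReal

variable {X : Type*} [MetricSpace X]

theorem cut_of_ne_zero (u : X → ℝ) {α : ℝ} (h : α ≠ 0) : cut u α = {x | α ≤ u x} :=
  if_neg h

theorem uZero_mem_Icc (x : ℝ) : uZero x ∈ Icc (0:ℝ) 1 := by
  unfold uZero
  split_ifs <;> norm_num

theorem cut_uSeq_half {n : ℕ} (hn : 1 ≤ n) : cut (uSeq n) (1/2) = Icc (0:ℝ) 1 := by
  rw [cut_of_ne_zero _ (by norm_num)]
  ext x
  simp only [mem_ofPred_eq, uSeq]
  split_ifs with h₁ h₂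
  · have := Real.rpow_le_one h₁.1 h₁.2 (by positivity : (0:ℝ) ≤ 1 / (n:ℝ))
    exact iff_of_true (by linarith) h₁
  · refine iff_of_false ?_ h₁
    have hx : 0 < x - 1 := by
      by_contra! h
      exact h₁ ⟨by linarith [h₂.1], by linarith⟩
    have := pow_pos hx n
    linarith
  · exact iff_of_false (by norm_num) h₁

theorem IsTimeChange.map_zero {t : ℝ → ℝ} (ht : IsTimeChange t) : t 0 = 0 := by
  obtain ⟨-, hmono, himage⟩ := ht
  have h0 : (0:ℝ) ∈ Icc (0:ℝ) 1 := by simp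
  obtain ⟨a, ha, hta⟩ := himage.ge h0
  exact le_antisymm (hta ▸ hmono.monotoneOn h0 ha ha.1) (himage.le ⟨0, h0, rfl⟩).1

/-- Level cuts of `t ∘ u` are level cuts of `u` at the preimage level. -/
theorem IsTimeChange.cut_comp {t : ℝ → ℝ} (ht : IsTimeChange t) {u : X → ℝ}
    (hu : ∀ x, u x ∈ Icc (0:ℝ) 1) {β : ℝ} (hβ : β ∈ Icc (0:ℝ) 1) (h : t β ≠ 0) :
    cut (fun x => t (u x)) (t β) = cut u β := by
  have hβ0 : β ≠ 0 := by
    rintro rfl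
    exact h ht.map_zero
  rw [cut_of_ne_zero _ h, cut_of_ne_zero _ hβ0]
  ext x
  exact ht.2.1.le_iff_le hβ (hu x)

theorem one_le_hausdorffEDist_Icc_cut_uZero {β : ℝ} (hβ : 0 < β) :
    1 ≤ Metric.hausdorffEDist (Icc (0:ℝ) 1) (cut uZero β) := by
  rw [cut_of_ne_zero _ hβ.ne']
  rcases le_or_gt β (1/2) with h | h
  · have h2 : (2:ℝ) ∈ {x | β ≤ uZero x} := by
      simpa [uZero] using h
    rw [Metric.hausdorffEDist_comm]
    refine le_trans ?_ (Metric.infEDist_le_hausdorffEDist_of_mem h2)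
    refine Metric.le_infEDist.2 fun y hy => ?_
    rw [edist_dist, ENNReal.one_le_ofReal, Real.dist_eq]
    exact le_trans (by linarith [hy.2]) (le_abs_self _)
  · have h1 : (1:ℝ) ∈ Icc (0:ℝ) 1 := by simp
    refine le_trans ?_ (Metric.infEDist_le_hausdorffEDist_of_mem h1)
    refine Metric.le_infEDist.2 fun y hy => ?_
    obtain rfl : y = 0 := by
      by_contra hy0
      simp only [mem_ofPred_eq, uZero, if_neg hy0] at hy
      split_ifs at hy <;> linarith
    simp [edist_dist]

theorem stmt13 :
    (∀ n : ℕ, 1 ≤ n → cut (uSeq n) (1/2) = Icc (0:ℝ) 1) ∧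
    (∀ t : ℝ → ℝ, IsTimeChange t → ∀ n : ℕ, 1 ≤ n → ∀ β ∈ Icc (0:ℝ) 1, t β = 1/2 →
      hausdorffEdist (cut (uSeq n) (1/2)) (cut uZero β) ≤
        dInfty (uSeq n) (fun x => t (uZero x)) ∧
      1 ≤ hausdorffEdist (cut (uSeq n) (1/2)) (cut uZero β)) := by
  refine ⟨fun n hn => cut_uSeq_half hn, fun t ht n hn β hβ h => ⟨?_, ?_⟩⟩
  · have hcut := ht.cut_comp uZero_mem_Icc hβ (by rw [h]; norm_num)
    rw [h] at hcut
    rw [← hcut]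
    exact hausdorffEDist_cut_le_dInfty _ _ (by norm_num)
  · rw [cut_uSeq_half hn]
    refine one_le_hausdorffEDist_Icc_cut_uZero (hβ.1.lt_of_ne ?_)
    rintro rfl
    norm_num [ht.map_zero] at h
end
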